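/- If f is a 0-homogeneous q-function, then L f is also 0-homogeneous, and L(L f) = L f; that is, L acts as a projection operator on the space of 0-homogeneous q-functions. -/

import Mathlib

noncomputable section

/-- The type of candidate local functions: functions of `x` and the jet `(q₀, q₁, …)`. -/
abbrev QFun := ℝ → (ℕ → ℝ) → ℝ

/-- `IsQFunc X m f` : `f` is a q-function of order `m` on `X`: it depends only on
`x, q_0, …, q_m` and is infinitely differentiable for `x ∈ X`, `q_0 > 0`. -/
def IsQFunc (X : Set ℝ) (m : ℕ) (f : QFun) : Prop :=
  ∃ F : ℝ × (Fin (m + 1) → ℝ) → ℝ,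
    ContDiffOn ℝ (⊤ : ℕ∞) F {p : ℝ × (Fin (m + 1) → ℝ) | p.1 ∈ X ∧ 0 < p.2 0} ∧
    ∀ x q, f x q = F (x, fun i => q i.val)

/-- Partial derivative with respect to `x`. -/
def pdx (f : QFun) : QFun := fun x q => deriv (fun t => f t q) x

/-- Partial derivative with respect to `q_j`. -/
def pd (j : ℕ) (f : QFun) : QFun :=
  fun x q => deriv (fun t => f x (Function.update q j t)) (q j)

/-- The total-derivative operator `D f = ∂f/∂x + Σ_j q_{j+1} ∂f/∂q_j`. -/
def Dop (f : QFun) : QFun :=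
  fun x q => pdx f x q + ∑' j : ℕ, q (j + 1) * pd j f x q

/-- The Lagrange operator `Λ f = Σ_k (-1)^k D^k (∂f/∂q_k)`. -/
def Lam (f : QFun) : QFun :=
  fun x q => ∑' k : ℕ, (-1 : ℝ) ^ k * Dop^[k] (pd k f) x q

/-- The operator `L f = Σ_k (-1)^(k+1) D^k (q_0 ∂f/∂q_k)`. -/
def Lop (f : QFun) : QFun :=
  fun x q => ∑' k : ℕ, (-1 : ℝ) ^ (k + 1) * Dop^[k] (fun y p => p 0 * pd k f y p) x q

/-- The Euler operator `E f = Σ_j q_j ∂f/∂q_j`. -/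
def Eop (f : QFun) : QFun := fun x q => ∑' j : ℕ, q j * pd j f x q

/-- The operator `B_r f = Σ_{k ≥ r+1} (-1)^(k-1-r) D^(k-1-r) (∂f/∂q_k)`, for `r ≥ -1`. -/
def Bop (r : ℤ) (f : QFun) : QFun :=
  fun x q => ∑' k : ℕ,
    if r + 1 ≤ (k : ℤ) then
      (-1 : ℝ) ^ ((k : ℤ) - 1 - r).toNat * Dop^[((k : ℤ) - 1 - r).toNat] (pd k f) x q
    else 0

/-- The operator `C f = Σ_{r ≥ 0} q_r B_r f`. -/
def Cop (f : QFun) : QFun := fun x q => ∑' r : ℕ, q r * Bop (r : ℤ) f x q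

/-- `f` is homogeneous of degree `h` in `(q_0, q_1, …)`. -/
def IsHomog (X : Set ℝ) (h : ℝ) (f : QFun) : Prop :=
  ∀ x ∈ X, ∀ q : ℕ → ℝ, 0 < q 0 → ∀ l : ℝ, 0 < l →
    f x (fun j => l * q j) = l ^ h * f x q

/-- `X` is a nonempty open (possibly infinite or semi-infinite) interval of `ℝ`. -/
def IsOpenInterval (X : Set ℝ) : Prop := IsOpen X ∧ X.OrdConnected ∧ X.Nonempty

section VariationalAlgebra

variable {A : Type*} [CommRing A] [Algebra ℝ A] {D : Module.End ℝ A} {P : ℕ → Module.End ℝ A}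
  {u : ℕ → A}

/-- The operator `L`, truncated to its first `N` terms, in an algebra with a total derivative `D`,
partial derivatives `P k` and first coordinate `v`. -/
def lagrangeSum (D : Module.End ℝ A) (P : ℕ → Module.End ℝ A) (v : A) (N : ℕ) (f : A) : A :=
  -∑ k ∈ Finset.range N, ((-D) ^ k) (v * P k f)

theorem lagrangeSum_eq_of_le {v : A} {N M : ℕ} {f : A} (hNM : N ≤ M)
    (hN : ∀ k, N ≤ k → P k f = 0) : lagrangeSum D P v N f = lagrangeSum D P v M f := by
  unfold lagrangeSum
  congr 1
  refine Finset.sum_subset (Finset.range_mono hNM) fun k _ hk => ?_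
  rw [hN k (by simpa using hk), mul_zero, map_zero]

theorem sum_neg_pow_partial_total (h0 : ∀ b, P 0 (D b) = D (P 0 b))
    (hs : ∀ k b, P (k + 1) (D b) = D (P (k + 1) b) + P k b) (h : A) (n : ℕ) :
    ∑ k ∈ Finset.range (n + 1), ((-D) ^ k) (P k (D h)) = ((-D) ^ n) (D (P n h)) := by
  induction n with
  | zero => simp [h0]
  | succ n ih =>
    rw [Finset.sum_range_succ, ih, hs, map_add, pow_succ (-D) n]
    simp [Module.End.mul_apply]

theorem exists_total_eq_mul_sub_mul_neg_pow (hD : ∀ k b, D (u k * b) = u (k + 1) * b + u k * D b)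
    (k : ℕ) (b : A) : ∃ h, D h = u k * b - u 0 * ((-D) ^ k) b := by
  induction k generalizing b with
  | zero => exact ⟨0, by simp⟩
  | succ k ih =>
    obtain ⟨h, hh⟩ := ih (-D b)
    refine ⟨u k * b + h, ?_⟩
    rw [map_add, hD, hh, pow_succ, Module.End.mul_apply, LinearMap.neg_apply]
    ring

theorem exists_total_eq_mul_lagrangeSum
    (hD : ∀ k b, D (u k * b) = u (k + 1) * b + u k * D b) {N : ℕ} {f : A}
    (hE : ∑ k ∈ Finset.range N, u k * P k f = 0) :
    ∃ h, D h = u 0 * lagrangeSum D P (u 0) N f := by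
  choose h hh using fun k => exists_total_eq_mul_sub_mul_neg_pow hD k (u 0 * P k f)
  refine ⟨∑ k ∈ Finset.range N, h k, ?_⟩
  have hE' : ∑ k ∈ Finset.range N, u k * (u 0 * P k f) = 0 := by
    rw [← mul_zero (u 0), ← hE, Finset.mul_sum]
    exact Finset.sum_congr rfl fun k _ => by ring
  rw [map_sum, Finset.sum_congr rfl fun k _ => hh k, Finset.sum_sub_distrib, hE', lagrangeSum,
    ← Finset.mul_sum]
  ring

theorem lagrangeSum_eq_self_of_total {h g : A}
    (hD : D h = u 0 * g) (hP0 : ∀ b, P 0 (u 0 * b) = b + u 0 * P 0 b)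
    (hPs : ∀ k b, P (k + 1) (u 0 * b) = u 0 * P (k + 1) b)
    (h0 : ∀ b, P 0 (D b) = D (P 0 b))
    (hs : ∀ k b, P (k + 1) (D b) = D (P (k + 1) b) + P k b)
    {M : ℕ} (hM : ∀ k, M ≤ k → P k g = 0) {K : ℕ} (hK : ∀ k, K ≤ k → P k h = 0) :
    lagrangeSum D P (u 0) M g = g := by
  rw [lagrangeSum_eq_of_le (show M ≤ max M K + 1 by omega) hM, lagrangeSum]
  have key := sum_neg_pow_partial_total h0 hs h (max M K)
  rw [hK _ (le_max_right _ _), map_zero, map_zero, hD, Finset.sum_range_succ', hP0] at key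
  rw [Finset.sum_range_succ']
  simp only [hPs, map_add, pow_zero, Module.End.one_apply] at key ⊢
  linear_combination -key

theorem neg_pow_apply_eq (D : Module.End ℝ A) (k : ℕ) (b : A) :
    ((-D) ^ k) b = (-1 : ℝ) ^ k • D^[k] b := by
  induction k with
  | zero => simp
  | succ k ih =>
    rw [pow_succ', Module.End.mul_apply, ih, Function.iterate_succ_apply', pow_succ]
    simp

end VariationalAlgebra

section Jets

/-- The truncation of a jet to the variables `x, q_0, …, q_m`. -/
def jetTrunc (m : ℕ) (x : ℝ) (q : ℕ → ℝ) : ℝ × (Fin (m + 1) → ℝ) := (x, fun i => q i.val)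

/-- The domain of definition of the q-functions of order `m`. -/
def jetDomain (X : Set ℝ) (m : ℕ) : Set (ℝ × (Fin (m + 1) → ℝ)) := {p | p.1 ∈ X ∧ 0 < p.2 0}

theorem isOpen_jetDomain {X : Set ℝ} (hX : IsOpen X) (m : ℕ) : IsOpen (jetDomain X m) :=
  (hX.preimage continuous_fst).inter
    (isOpen_lt continuous_const ((continuous_apply 0).comp continuous_snd))

theorem jetTrunc_mem {X : Set ℝ} {m : ℕ} {x : ℝ} {q : ℕ → ℝ} (hx : x ∈ X) (hq : 0 < q 0) :
    jetTrunc m x q ∈ jetDomain X m := ⟨hx, by simpa [jetTrunc] using hq⟩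

/-- On the domain, `f` is given by the smooth function `F` of `x, q_0, …, q_m`. -/
def JetRep (X : Set ℝ) (m : ℕ) (F : ℝ × (Fin (m + 1) → ℝ) → ℝ) (f : QFun) : Prop :=
  ContDiffOn ℝ (⊤ : ℕ∞) F (jetDomain X m) ∧
    ∀ x ∈ X, ∀ q : ℕ → ℝ, 0 < q 0 → f x q = F (jetTrunc m x q)

variable {X : Set ℝ} {m n : ℕ} {f g : QFun} {F G : ℝ × (Fin (m + 1) → ℝ) → ℝ}

/-- Forgetting the variables of order above `m`. -/
def jetProj (h : m ≤ n) : (ℝ × (Fin (n + 1) → ℝ)) →L[ℝ] ℝ × (Fin (m + 1) → ℝ) :=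
  (ContinuousLinearMap.fst ℝ ℝ _).prod
    (ContinuousLinearMap.pi fun i : Fin (m + 1) =>
      (ContinuousLinearMap.proj (⟨i.val, by omega⟩ : Fin (n + 1))).comp
        (ContinuousLinearMap.snd ℝ ℝ _))

theorem jetProj_jetTrunc (h : m ≤ n) (x : ℝ) (q : ℕ → ℝ) :
    jetProj h (jetTrunc n x q) = jetTrunc m x q := rfl

theorem mapsTo_jetProj (h : m ≤ n) : Set.MapsTo (jetProj h) (jetDomain X n) (jetDomain X m) :=
  fun _ hp => hp

theorem JetRep.mono (hF : JetRep X m F f) (h : m ≤ n) : JetRep X n (F ∘ jetProj h) f :=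
  ⟨hF.1.comp (jetProj h).contDiff.contDiffOn (mapsTo_jetProj h), hF.2⟩

theorem JetRep.congr (hF : JetRep X m F f)
    (hfg : ∀ x ∈ X, ∀ q : ℕ → ℝ, 0 < q 0 → g x q = f x q) : JetRep X m F g :=
  ⟨hF.1, fun x hx q hq => (hfg x hx q hq).trans (hF.2 x hx q hq)⟩

theorem JetRep.add (hF : JetRep X m F f) (hG : JetRep X m G g) : JetRep X m (F + G) (f + g) :=
  ⟨hF.1.add hG.1, fun x hx q hq => congrArg₂ (· + ·) (hF.2 x hx q hq) (hG.2 x hx q hq)⟩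

theorem JetRep.mul (hF : JetRep X m F f) (hG : JetRep X m G g) : JetRep X m (F * G) (f * g) :=
  ⟨hF.1.mul hG.1, fun x hx q hq => congrArg₂ (· * ·) (hF.2 x hx q hq) (hG.2 x hx q hq)⟩

theorem JetRep.const_smul (c : ℝ) (hF : JetRep X m F f) : JetRep X m (c • F) (c • f) :=
  ⟨contDiffOn_const.smul hF.1, fun x hx q hq => congrArg (c * ·) (hF.2 x hx q hq)⟩

theorem jetRep_const (c : ℝ) : JetRep X 0 (fun _ => c) (fun _ _ => c) :=
  ⟨contDiffOn_const, fun _ _ _ _ => rfl⟩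

theorem jetRep_coord (k : ℕ) :
    JetRep X k (fun p => p.2 (Fin.last k)) (fun _ q => q k) :=
  ⟨by fun_prop, fun _ _ _ _ => rfl⟩

theorem JetRep.contDiffAt (hX : IsOpen X) (hF : JetRep X m F f) {x : ℝ} {q : ℕ → ℝ}
    (hx : x ∈ X) (hq : 0 < q 0) : ContDiffAt ℝ (⊤ : ℕ∞) F (jetTrunc m x q) :=
  hF.1.contDiffAt ((isOpen_jetDomain hX m).mem_nhds (jetTrunc_mem hx hq))

theorem JetRep.differentiableAt (hX : IsOpen X) (hF : JetRep X m F f) {x : ℝ} {q : ℕ → ℝ}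
    (hx : x ∈ X) (hq : 0 < q 0) : DifferentiableAt ℝ F (jetTrunc m x q) :=
  (hF.contDiffAt hX hx hq).differentiableAt (by simp)

theorem JetRep.contDiffOn_fderiv (hX : IsOpen X) (hF : JetRep X m F f) :
    ContDiffOn ℝ (⊤ : ℕ∞) (fderiv ℝ F) (jetDomain X m) :=
  hF.1.fderiv_of_isOpen (isOpen_jetDomain hX m) (by simp)

/-- The direction of `q_j` in the jets of order `m`, zero when `m < j`. -/
def jetUnit (j m : ℕ) : ℝ × (Fin (m + 1) → ℝ) := jetTrunc m 0 (Pi.single j 1)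

/-- The direction of the total derivative at a jet `q`. -/
def jetShift (q : ℕ → ℝ) (m : ℕ) : ℝ × (Fin (m + 1) → ℝ) := jetTrunc m 1 fun j => q (j + 1)

theorem jetUnit_eq_zero {j m : ℕ} (h : m < j) : jetUnit j m = 0 := by
  refine Prod.ext rfl (funext fun i => ?_)
  exact Pi.single_eq_of_ne (by omega) _

theorem JetRep.hasDerivAt (hX : IsOpen X) (hF : JetRep X m F f) {x : ℝ} {q : ℕ → ℝ}
    (hx : x ∈ X) (hq : 0 < q 0) {y : ℝ → ℝ} {p : ℝ → ℕ → ℝ} {t : ℝ}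
    {d : ℝ × (Fin (m + 1) → ℝ)} (hy : y t = x) (hp : p t = q)
    (hd : HasDerivAt (fun s => jetTrunc m (y s) (p s)) d t) :
    HasDerivAt (fun s => f (y s) (p s)) (fderiv ℝ F (jetTrunc m x q) d) t := by
  have h1 := (hF.differentiableAt hX hx hq).hasFDerivAt
  have hpt : jetTrunc m (y t) (p t) = jetTrunc m x q := by rw [hy, hp]
  rw [← hpt] at h1 ⊢
  refine (h1.comp_hasDerivAt t hd).congr_of_eventuallyEq ?_
  have hmem : jetTrunc m (y t) (p t) ∈ jetDomain X m := hpt ▸ jetTrunc_mem hx hq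
  filter_upwards [hd.continuousAt.preimage_mem_nhds ((isOpen_jetDomain hX m).mem_nhds hmem)]
    with s hs
  exact hF.2 _ hs.1 _ (by simpa [jetTrunc] using hs.2)

theorem JetRep.pd_eq (hX : IsOpen X) (hF : JetRep X m F f) (j : ℕ) {x : ℝ} {q : ℕ → ℝ}
    (hx : x ∈ X) (hq : 0 < q 0) :
    pd j f x q = fderiv ℝ F (jetTrunc m x q) (jetUnit j m) := by
  refine (hF.hasDerivAt hX hx hq (y := fun _ => x) rfl (Function.update_eq_self j q) ?_).deriv
  refine (hasDerivAt_const _ _).prodMk (hasDerivAt_pi.2 fun i => ?_)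
  by_cases h : i.val = j
  · subst h
    simpa using hasDerivAt_id' (q i.val)
  · simpa [h] using hasDerivAt_const (q j) (q i.val)

theorem JetRep.pdx_eq (hX : IsOpen X) (hF : JetRep X m F f) {x : ℝ} {q : ℕ → ℝ}
    (hx : x ∈ X) (hq : 0 < q 0) :
    pdx f x q = fderiv ℝ F (jetTrunc m x q) (1, 0) := by
  refine (hF.hasDerivAt hX hx hq (y := fun t => t) (p := fun _ => q) rfl rfl ?_).deriv
  exact (hasDerivAt_id _).prodMk (hasDerivAt_const _ _)

theorem JetRep.sum_mul_pd_eq (hX : IsOpen X) (hF : JetRep X m F f) {x : ℝ} {q : ℕ → ℝ}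
    (hx : x ∈ X) (hq : 0 < q 0) (c : ℕ → ℝ) :
    ∑ j ∈ Finset.range (m + 1), c j * pd j f x q =
      fderiv ℝ F (jetTrunc m x q) (jetTrunc m 0 c) := by
  have hc : jetTrunc m 0 c = ∑ j ∈ Finset.range (m + 1), c j • jetUnit j m := by
    refine Prod.ext ?_ (funext fun i => ?_)
    · simp [jetTrunc, jetUnit, Prod.fst_sum]
    · have hi : i.val ∈ Finset.range (m + 1) := Finset.mem_range.2 i.isLt
      simp only [jetTrunc, jetUnit, Prod.snd_sum, Finset.sum_apply, Prod.smul_snd, Pi.smul_apply,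
        smul_eq_mul]
      rw [Finset.sum_eq_single_of_mem i.val hi fun j _ hj => by
        rw [Pi.single_eq_of_ne hj.symm, mul_zero]]
      simp
  simp [hc, map_sum, hF.pd_eq hX _ hx hq]

theorem JetRep.pd_eq_zero (hX : IsOpen X) (hF : JetRep X m F f) {j : ℕ} (hj : m < j) {x : ℝ}
    {q : ℕ → ℝ} (hx : x ∈ X) (hq : 0 < q 0) : pd j f x q = 0 := by
  rw [hF.pd_eq hX j hx hq, jetUnit_eq_zero hj, map_zero]

theorem JetRep.Dop_eq (hX : IsOpen X) (hF : JetRep X m F f) {x : ℝ} {q : ℕ → ℝ}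
    (hx : x ∈ X) (hq : 0 < q 0) :
    Dop f x q = fderiv ℝ F (jetTrunc m x q) (jetShift q m) := by
  rw [Dop, tsum_eq_sum (s := Finset.range (m + 1)) fun j hj => by
      rw [hF.pd_eq_zero hX (by simpa using hj) hx hq, mul_zero],
    hF.sum_mul_pd_eq hX hx hq fun j => q (j + 1), hF.pdx_eq hX hx hq, ← map_add]
  congr 1
  exact Prod.ext (by simp [jetTrunc, jetShift]) (by simp [jetTrunc, jetShift])

theorem JetRep.pd (hX : IsOpen X) (hF : JetRep X m F f) (j : ℕ) :
    JetRep X m (fun p => fderiv ℝ F p (jetUnit j m)) (pd j f) :=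
  ⟨(hF.contDiffOn_fderiv hX).clm_apply contDiffOn_const, fun _ hx _ hq => hF.pd_eq hX j hx hq⟩

/-- The linear part of the direction of the total derivative. -/
def jetShiftCLM (m : ℕ) : (ℝ × (Fin (m + 1 + 1) → ℝ)) →L[ℝ] ℝ × (Fin (m + 1) → ℝ) :=
  (0 : (ℝ × (Fin (m + 1 + 1) → ℝ)) →L[ℝ] ℝ).prod
    (ContinuousLinearMap.pi fun i : Fin (m + 1) =>
      (ContinuousLinearMap.proj i.succ).comp (ContinuousLinearMap.snd ℝ ℝ _))

theorem jetShiftCLM_jetTrunc (m : ℕ) (x : ℝ) (q : ℕ → ℝ) :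
    jetShiftCLM m (jetTrunc (m + 1) x q) = jetTrunc m 0 fun j => q (j + 1) := rfl

theorem jetShift_eq (q : ℕ → ℝ) (x : ℝ) :
    jetShift q m = (1, 0) + jetShiftCLM m (jetTrunc (m + 1) x q) :=
  Prod.ext (by simp [jetShiftCLM_jetTrunc, jetTrunc.eq_1 m, jetShift])
    (by simp [jetShiftCLM_jetTrunc, jetTrunc.eq_1 m, jetShift])

theorem JetRep.Dop (hX : IsOpen X) (hF : JetRep X m F f) :
    JetRep X (m + 1)
      (fun p => fderiv ℝ F (jetProj m.le_succ p) ((1, 0) + jetShiftCLM m p)) (Dop f) := by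
  refine ⟨((hF.contDiffOn_fderiv hX).comp (jetProj m.le_succ).contDiff.contDiffOn
    (mapsTo_jetProj _)).clm_apply (by fun_prop), fun x hx q hq => ?_⟩
  beta_reduce
  rw [hF.Dop_eq hX hx hq, jetProj_jetTrunc, jetShift_eq q x]

theorem JetRep.pd_Dop (hX : IsOpen X) (hF : JetRep X m F f) (k : ℕ) {x : ℝ} {q : ℕ → ℝ}
    (hx : x ∈ X) (hq : 0 < q 0) :
    _root_.pd k (_root_.Dop f) x q = _root_.Dop (_root_.pd k f) x q +
      fderiv ℝ F (jetTrunc m x q) (jetShiftCLM m (jetUnit k (m + 1))) := by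
  have h2 : DifferentiableAt ℝ (fderiv ℝ F) (jetTrunc m x q) :=
    ((hF.contDiffOn_fderiv hX).contDiffAt
      ((isOpen_jetDomain hX m).mem_nhds (jetTrunc_mem hx hq))).differentiableAt (by simp)
  have hsymm : IsSymmSndFDerivAt ℝ F (jetTrunc m x q) :=
    (hF.contDiffAt hX hx hq).isSymmSndFDerivAt (by
      rw [minSmoothness_of_isRCLikeNormedField]
      exact WithTop.coe_le_coe.2 (le_top (a := (2 : ℕ∞))))
  rw [(hF.Dop hX).pd_eq hX k hx hq, (hF.pd hX k).Dop_eq hX hx hq]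
  have e1 := (h2.hasFDerivAt.clm_apply (hasFDerivAt_const (jetUnit k m) _)).fderiv
  have h3 : HasFDerivAt (fun p => fderiv ℝ F (jetProj m.le_succ p))
      ((fderiv ℝ (fderiv ℝ F) (jetTrunc m x q)).comp (jetProj m.le_succ))
      (jetTrunc (m + 1) x q) :=
    HasFDerivAt.comp (g := fderiv ℝ F) _ h2.hasFDerivAt (jetProj m.le_succ).hasFDerivAt
  have e2 := (h3.clm_apply ((jetShiftCLM m).hasFDerivAt.const_add (1, 0))).fderiv
  rw [e1, e2, ← jetShift_eq, jetProj_jetTrunc]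
  have hu : jetProj m.le_succ (jetUnit k (m + 1)) = jetUnit k m := rfl
  simp [hu, hsymm.eq (jetUnit k m), add_comm]

theorem jetShiftCLM_jetUnit_zero (m : ℕ) : jetShiftCLM m (jetUnit 0 (m + 1)) = 0 :=
  Prod.ext rfl (funext fun i =>
    Pi.single_eq_of_ne (M := fun _ => ℝ) (Nat.succ_ne_zero i.val) 1)

theorem jetShiftCLM_jetUnit_succ (k m : ℕ) :
    jetShiftCLM m (jetUnit (k + 1) (m + 1)) = jetUnit k m :=
  Prod.ext rfl (funext fun i => by
    
    simp only [jetUnit, jetShiftCLM_jetTrunc]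
    simp [jetTrunc, Pi.single_apply])

end Jets

section JetAlgebra

/-- The jets on which q-functions are defined. -/
abbrev JetSpace (X : Set ℝ) : Type := {p : ℝ × (ℕ → ℝ) // p.1 ∈ X ∧ 0 < p.2 0}

/-- Extension by zero off the jets on which q-functions are defined. -/
def jetExtend {X : Set ℝ} (a : JetSpace X → ℝ) : QFun :=
  open Classical in fun x q => if h : x ∈ X ∧ 0 < q 0 then a ⟨(x, q), h⟩ else 0

variable {X : Set ℝ}

theorem jetExtend_apply (a : JetSpace X → ℝ) {x : ℝ} {q : ℕ → ℝ} (hx : x ∈ X) (hq : 0 < q 0) :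
    jetExtend a x q = a ⟨(x, q), hx, hq⟩ := dif_pos ⟨hx, hq⟩

theorem jetExtend_comp {O : ℝ → ℝ → ℝ} (a b : JetSpace X → ℝ) {x : ℝ} {q : ℕ → ℝ} (hx : x ∈ X)
    (hq : 0 < q 0) : jetExtend (fun p => O (a p) (b p)) x q =
      O (jetExtend a x q) (jetExtend b x q) := by
  simp only [jetExtend_apply _ hx hq]

/-- The algebra of q-functions, as functions on their domain. -/
def jetAlgebra (X : Set ℝ) : Subalgebra ℝ (JetSpace X → ℝ) where
  carrier := {a | ∃ m F, JetRep X m F (jetExtend a)}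
  mul_mem' := by
    rintro a b ⟨m, F, hF⟩ ⟨n, G, hG⟩
    exact ⟨_, _, ((hF.mono (le_max_left m n)).mul (hG.mono (le_max_right m n))).congr
      fun x hx q hq => jetExtend_comp (O := (· * ·)) a b hx hq⟩
  add_mem' := by
    rintro a b ⟨m, F, hF⟩ ⟨n, G, hG⟩
    exact ⟨_, _, ((hF.mono (le_max_left m n)).add (hG.mono (le_max_right m n))).congr
      fun x hx q hq => jetExtend_comp (O := (· + ·)) a b hx hq⟩
  algebraMap_mem' := fun c =>
    ⟨0, _, (jetRep_const c).congr fun x hx q hq => jetExtend_apply _ hx hq⟩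

/-- The element of the algebra of q-functions given by a q-function. -/
def toJetAlgebra (f : QFun) (hf : ∃ m F, JetRep X m F f) : jetAlgebra X :=
  ⟨fun p => f p.1.1 p.1.2, by
    obtain ⟨m, F, hF⟩ := hf
    exact ⟨m, F, hF.congr fun x hx q hq => jetExtend_apply _ hx hq⟩⟩

/-- `f` agrees with `a` on the domain of q-functions. -/
def Represents (f : QFun) (a : jetAlgebra X) : Prop :=
  ∀ x hx q hq, f x q = a.1 ⟨(x, q), hx, hq⟩

theorem represents_jetExtend (a : jetAlgebra X) : Represents (jetExtend a.1) a :=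
  fun _ hx _ hq => jetExtend_apply a.1 hx hq

theorem Represents.exists_jetRep {f : QFun} {a : jetAlgebra X} (h : Represents f a) :
    ∃ m F, JetRep X m F f := by
  obtain ⟨m, F, hF⟩ := a.2
  exact ⟨m, F, hF.congr fun x hx q hq =>
    (h x hx q hq).trans (represents_jetExtend a x hx q hq).symm⟩

theorem Represents.eq {f g : QFun} {a b : jetAlgebra X} (hf : Represents f a)
    (hg : Represents g b) (h : ∀ x ∈ X, ∀ q : ℕ → ℝ, 0 < q 0 → f x q = g x q) : a = b := by
  refine Subtype.ext (funext fun ⟨⟨x, q⟩, hx, hq⟩ => ?_)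
  rw [← hf x hx q hq, ← hg x hx q hq, h x hx q hq]

theorem Represents.mul {f g : QFun} {a b : jetAlgebra X} (hf : Represents f a)
    (hg : Represents g b) : Represents (fun x q => f x q * g x q) (a * b) :=
  fun x hx q hq => congrArg₂ (· * ·) (hf x hx q hq) (hg x hx q hq)

theorem Represents.add {f g : QFun} {a b : jetAlgebra X} (hf : Represents f a)
    (hg : Represents g b) : Represents (fun x q => f x q + g x q) (a + b) :=
  fun x hx q hq => congrArg₂ (· + ·) (hf x hx q hq) (hg x hx q hq)

/-- `O` acts on q-functions as differentiation in the direction `d`. -/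
structure IsDirDeriv (X : Set ℝ) (O : QFun → QFun)
    (d : (ℕ → ℝ) → (m : ℕ) → ℝ × (Fin (m + 1) → ℝ)) : Prop where
  apply_eq : ∀ {m F f}, JetRep X m F f → ∀ {x q}, x ∈ X → 0 < q 0 →
    O f x q = fderiv ℝ F (jetTrunc m x q) (d q m)
  exists_jetRep : ∀ {m F f}, JetRep X m F f → ∃ n G, JetRep X n G (O f)

variable {O : QFun → QFun} {d : (ℕ → ℝ) → (m : ℕ) → ℝ × (Fin (m + 1) → ℝ)}

theorem isDirDeriv_pd (hX : IsOpen X) (j : ℕ) : IsDirDeriv X (pd j) fun _ => jetUnit j :=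
  ⟨fun hF _ _ hx hq => hF.pd_eq hX j hx hq, fun hF => ⟨_, _, hF.pd hX j⟩⟩

theorem isDirDeriv_Dop (hX : IsOpen X) : IsDirDeriv X Dop jetShift :=
  ⟨fun hF _ _ hx hq => hF.Dop_eq hX hx hq, fun hF => ⟨_, _, hF.Dop hX⟩⟩

namespace IsDirDeriv

theorem congr (hO : IsDirDeriv X O d) {f g : QFun} {a : jetAlgebra X} (hf : Represents f a)
    (hg : Represents g a) {x : ℝ} {q : ℕ → ℝ} (hx : x ∈ X) (hq : 0 < q 0) :
    O f x q = O g x q := by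
  obtain ⟨m, F, hF⟩ := hf.exists_jetRep
  rw [hO.apply_eq hF hx hq, hO.apply_eq (hF.congr fun x hx q hq =>
    (hg x hx q hq).trans (hf x hx q hq).symm) hx hq]

theorem apply_add (hX : IsOpen X) (hO : IsDirDeriv X O d) {f g : QFun}
    (hf : ∃ m F, JetRep X m F f) (hg : ∃ m F, JetRep X m F g) {x : ℝ} {q : ℕ → ℝ}
    (hx : x ∈ X) (hq : 0 < q 0) : O (f + g) x q = O f x q + O g x q := by
  obtain ⟨m, F, hF⟩ := hf
  obtain ⟨n, G, hG⟩ := hg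
  have hF := hF.mono (le_max_left m n)
  have hG := hG.mono (le_max_right m n)
  rw [hO.apply_eq (hF.add hG) hx hq, hO.apply_eq hF hx hq, hO.apply_eq hG hx hq,
    fderiv_add (hF.differentiableAt hX hx hq) (hG.differentiableAt hX hx hq)]
  rfl

theorem apply_mul (hX : IsOpen X) (hO : IsDirDeriv X O d) {f g : QFun}
    (hf : ∃ m F, JetRep X m F f) (hg : ∃ m F, JetRep X m F g) {x : ℝ} {q : ℕ → ℝ}
    (hx : x ∈ X) (hq : 0 < q 0) : O (f * g) x q = O f x q * g x q + f x q * O g x q := by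
  obtain ⟨m, F, hF⟩ := hf
  obtain ⟨n, G, hG⟩ := hg
  have hF := hF.mono (le_max_left m n)
  have hG := hG.mono (le_max_right m n)
  rw [hO.apply_eq (hF.mul hG) hx hq, hO.apply_eq hF hx hq, hO.apply_eq hG hx hq,
    fderiv_mul (hF.differentiableAt hX hx hq) (hG.differentiableAt hX hx hq),
    hF.2 x hx q hq, hG.2 x hx q hq]
  simp only [add_apply, smul_apply, smul_eq_mul]
  ring

theorem apply_smul (hX : IsOpen X) (hO : IsDirDeriv X O d) (c : ℝ) {f : QFun}
    (hf : ∃ m F, JetRep X m F f) {x : ℝ} {q : ℕ → ℝ} (hx : x ∈ X) (hq : 0 < q 0) :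
    O (c • f) x q = c * O f x q := by
  obtain ⟨m, F, hF⟩ := hf
  rw [hO.apply_eq (hF.const_smul c) hx hq, hO.apply_eq hF hx hq,
    fderiv_const_smul (hF.differentiableAt hX hx hq)]
  rfl

/-- The endomorphism of the algebra of q-functions given by a directional derivative. -/
def toEnd (hX : IsOpen X) (hO : IsDirDeriv X O d) : Module.End ℝ (jetAlgebra X) where
  toFun a := toJetAlgebra (O (jetExtend a.1)) (by
    obtain ⟨m, F, hF⟩ := a.2
    exact hO.exists_jetRep hF)
  map_add' a b := Subtype.ext (funext fun ⟨⟨x, q⟩, hx, hq⟩ =>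
    (hO.congr (represents_jetExtend _)
      ((represents_jetExtend a).add (represents_jetExtend b)) hx hq).trans
      (hO.apply_add hX a.2 b.2 hx hq))
  map_smul' c a := Subtype.ext (funext fun ⟨⟨x, q⟩, hx, hq⟩ =>
    (hO.congr (represents_jetExtend _)
      (fun x hx q hq => congrArg (c * ·) (represents_jetExtend a x hx q hq)) hx hq).trans
      (hO.apply_smul hX c a.2 hx hq))

theorem represents (hX : IsOpen X) (hO : IsDirDeriv X O d) {f : QFun} {a : jetAlgebra X}
    (h : Represents f a) : Represents (O f) (hO.toEnd hX a) :=
  fun _ hx _ hq => hO.congr h (represents_jetExtend a) hx hq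

theorem represents_iterate (hX : IsOpen X) (hO : IsDirDeriv X O d) {f : QFun} {a : jetAlgebra X}
    (h : Represents f a) (k : ℕ) : Represents (O^[k] f) ((hO.toEnd hX)^[k] a) := by
  induction k with
  | zero => exact h
  | succ k ih =>
    rw [Function.iterate_succ_apply', Function.iterate_succ_apply']
    exact hO.represents hX ih

theorem toEnd_mul (hX : IsOpen X) (hO : IsDirDeriv X O d) (a b : jetAlgebra X) :
    hO.toEnd hX (a * b) = hO.toEnd hX a * b + a * hO.toEnd hX b :=
  (hO.represents hX ((represents_jetExtend a).mul (represents_jetExtend b))).eq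
    (((hO.represents hX (represents_jetExtend a)).mul (represents_jetExtend b)).add
      ((represents_jetExtend a).mul (hO.represents hX (represents_jetExtend b))))
    fun _ hx _ hq => hO.apply_mul hX a.2 b.2 hx hq

end IsDirDeriv

/-- The total derivative on the algebra of q-functions. -/
def jetTotal (hX : IsOpen X) : Module.End ℝ (jetAlgebra X) := (isDirDeriv_Dop hX).toEnd hX

/-- The partial derivatives on the algebra of q-functions. -/
def jetPartial (hX : IsOpen X) (k : ℕ) : Module.End ℝ (jetAlgebra X) :=
  (isDirDeriv_pd hX k).toEnd hX

/-- The coordinate `q_k` in the algebra of q-functions. -/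
def jetCoord (X : Set ℝ) (k : ℕ) : jetAlgebra X :=
  toJetAlgebra (fun _ q => q k) ⟨_, _, jetRep_coord k⟩

theorem represents_jetCoord (k : ℕ) : Represents (fun _ q => q k) (jetCoord X k) :=
  fun _ _ _ _ => rfl

theorem pd_coord (j k : ℕ) (x : ℝ) (q : ℕ → ℝ) :
    pd j (fun _ q => q k) x q = if j = k then 1 else 0 := by
  by_cases h : j = k
  · subst h
    simp [pd]
  · simp [pd, h, Function.update_of_ne (Ne.symm h)]

theorem Dop_coord (k : ℕ) (x : ℝ) (q : ℕ → ℝ) : Dop (fun _ q => q k) x q = q (k + 1) := by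
  rw [Dop, tsum_eq_single k fun j hj => by rw [pd_coord, if_neg hj, mul_zero]]
  simp [pdx, pd_coord]

theorem jetTotal_coord (hX : IsOpen X) (k : ℕ) :
    jetTotal hX (jetCoord X k) = jetCoord X (k + 1) :=
  ((isDirDeriv_Dop hX).represents hX (represents_jetCoord k)).eq (represents_jetCoord (k + 1))
    fun x _ q _ => Dop_coord k x q

theorem jetPartial_zero_coord (hX : IsOpen X) : jetPartial hX 0 (jetCoord X 0) = 1 :=
  ((isDirDeriv_pd hX 0).represents hX (represents_jetCoord 0)).eq
    (g := fun _ _ => 1) (fun _ _ _ _ => rfl) fun x _ q _ => by simp [pd_coord]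

theorem jetPartial_succ_coord (hX : IsOpen X) (k : ℕ) :
    jetPartial hX (k + 1) (jetCoord X 0) = 0 :=
  ((isDirDeriv_pd hX (k + 1)).represents hX (represents_jetCoord 0)).eq
    (g := fun _ _ => 0) (fun _ _ _ _ => rfl) fun x _ q _ => by simp [pd_coord]

theorem jetPartial_zero_total (hX : IsOpen X) (a : jetAlgebra X) :
    jetPartial hX 0 (jetTotal hX a) = jetTotal hX (jetPartial hX 0 a) := by
  have ha := represents_jetExtend a
  obtain ⟨m, F, hF⟩ := a.2
  refine ((isDirDeriv_pd hX 0).represents hX ((isDirDeriv_Dop hX).represents hX ha)).eq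
    ((isDirDeriv_Dop hX).represents hX ((isDirDeriv_pd hX 0).represents hX ha))
    fun x hx q hq => ?_
  rw [hF.pd_Dop hX 0 hx hq, jetShiftCLM_jetUnit_zero, map_zero, add_zero]

theorem jetPartial_succ_total (hX : IsOpen X) (k : ℕ) (a : jetAlgebra X) :
    jetPartial hX (k + 1) (jetTotal hX a) =
      jetTotal hX (jetPartial hX (k + 1) a) + jetPartial hX k a := by
  have ha := represents_jetExtend a
  obtain ⟨m, F, hF⟩ := a.2
  refine ((isDirDeriv_pd hX (k + 1)).represents hX ((isDirDeriv_Dop hX).represents hX ha)).eq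
    (((isDirDeriv_Dop hX).represents hX ((isDirDeriv_pd hX (k + 1)).represents hX ha)).add
      ((isDirDeriv_pd hX k).represents hX ha)) fun x hx q hq => ?_
  rw [hF.pd_Dop hX (k + 1) hx hq, jetShiftCLM_jetUnit_succ, hF.pd_eq hX k hx hq]

theorem exists_jetPartial_eq_zero (hX : IsOpen X) (a : jetAlgebra X) :
    ∃ N, ∀ k, N ≤ k → jetPartial hX k a = 0 := by
  obtain ⟨m, F, hF⟩ := a.2
  exact ⟨m + 1, fun k hk => ((isDirDeriv_pd hX k).represents hX (represents_jetExtend a)).eq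
    (g := fun _ _ => 0) (fun _ _ _ _ => rfl) fun x hx q hq => hF.pd_eq_zero hX hk hx hq⟩

theorem Represents.Lop (hX : IsOpen X) {f : QFun} {a : jetAlgebra X} (h : Represents f a) {N : ℕ}
    (hN : ∀ k, N ≤ k → jetPartial hX k a = 0) :
    Represents (Lop f) (lagrangeSum (jetTotal hX) (jetPartial hX) (jetCoord X 0) N a) := by
  intro x hx q hq
  have hterm : ∀ k, Dop^[k] (fun y p => p 0 * pd k f y p) x q =
      ((jetTotal hX)^[k] (jetCoord X 0 * jetPartial hX k a)).1 ⟨(x, q), hx, hq⟩ := fun k =>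
    (isDirDeriv_Dop hX).represents_iterate hX
      ((represents_jetCoord 0).mul ((isDirDeriv_pd hX k).represents hX h)) k x hx q hq
  rw [_root_.Lop, tsum_eq_sum (s := Finset.range N) fun k hk => by
    rw [hterm, hN k (by simpa using hk), mul_zero, iterate_map_zero]
    exact mul_zero _]
  simp only [lagrangeSum, neg_pow_apply_eq, hterm, ← Finset.sum_neg_distrib]
  simp [Finset.sum_apply, pow_succ]

theorem lagrangeSum_jet_idem (hX : IsOpen X) {a : jetAlgebra X} {N M : ℕ}
    (hE : ∑ k ∈ Finset.range N, jetCoord X k * jetPartial hX k a = 0)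
    (hM : ∀ k, M ≤ k → jetPartial hX k
      (lagrangeSum (jetTotal hX) (jetPartial hX) (jetCoord X 0) N a) = 0) :
    lagrangeSum (jetTotal hX) (jetPartial hX) (jetCoord X 0) M
      (lagrangeSum (jetTotal hX) (jetPartial hX) (jetCoord X 0) N a) =
    lagrangeSum (jetTotal hX) (jetPartial hX) (jetCoord X 0) N a := by
  have hmulT : ∀ a b, jetTotal hX (a * b) = jetTotal hX a * b + a * jetTotal hX b :=
    (isDirDeriv_Dop hX).toEnd_mul hX
  have hmulP : ∀ k a b, jetPartial hX k (a * b) = jetPartial hX k a * b + a * jetPartial hX k b :=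
    fun k => (isDirDeriv_pd hX k).toEnd_mul hX
  obtain ⟨h, hh⟩ := exists_total_eq_mul_lagrangeSum (u := jetCoord X)
    (fun k b => by rw [hmulT, jetTotal_coord]) hE
  obtain ⟨K, hK⟩ := exists_jetPartial_eq_zero hX h
  exact lagrangeSum_eq_self_of_total hh
    (fun b => by rw [hmulP, jetPartial_zero_coord, one_mul])
    (fun k b => by rw [hmulP, jetPartial_succ_coord, zero_mul, zero_add])
    (jetPartial_zero_total hX) (jetPartial_succ_total hX) hM hK

end JetAlgebra

section Homogeneity

variable {X : Set ℝ} {f : QFun} {h : ℝ}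

theorem JetRep.sum_mul_pd_eq_zero {m : ℕ} {F : ℝ × (Fin (m + 1) → ℝ) → ℝ} (hX : IsOpen X)
    (hF : JetRep X m F f) (hf : IsHomog X 0 f) {x : ℝ} {q : ℕ → ℝ} (hx : x ∈ X) (hq : 0 < q 0) :
    ∑ j ∈ Finset.range (m + 1), q j * _root_.pd j f x q = 0 := by
  rw [hF.sum_mul_pd_eq hX hx hq]
  have h1 : HasDerivAt (fun l : ℝ => f x fun j => l * q j)
      (fderiv ℝ F (jetTrunc m x q) (jetTrunc m 0 q)) 1 := by
    refine hF.hasDerivAt hX hx hq (y := fun _ => x) rfl (funext fun j => one_mul _) ?_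
    refine (hasDerivAt_const _ _).prodMk (hasDerivAt_pi.2 fun i => ?_)
    simpa using (hasDerivAt_id (1 : ℝ)).mul_const (q i.val)
  refine h1.unique ((hasDerivAt_const (1 : ℝ) (f x q)).congr_of_eventuallyEq ?_)
  filter_upwards [lt_mem_nhds (zero_lt_one (α := ℝ))] with l hl
  simp [hf x hx q hq l hl]

theorem IsHomog.pd (hf : IsHomog X h f) (k : ℕ) : IsHomog X (h - 1) (pd k f) := by
  intro x hx q hq l hl
  have heq : (fun t => f x (Function.update (fun j => l * q j) k t)) =ᶠ[nhds (l * q k)]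
      fun t => l ^ h * f x (Function.update q k (l⁻¹ * t)) := by
    have hcont : ContinuousAt (fun t : ℝ => Function.update q k (l⁻¹ * t) 0) (l * q k) := by
      have : Continuous fun t : ℝ => Function.update q k (l⁻¹ * t) := by fun_prop
      exact ((continuous_apply 0).comp this).continuousAt
    have hpos : 0 < Function.update q k (l⁻¹ * (l * q k)) 0 := by
      rwa [inv_mul_cancel_left₀ hl.ne', Function.update_eq_self]
    filter_upwards [hcont.eventually (lt_mem_nhds hpos)] with t ht
    rw [← hf x hx _ ht l hl]
    congr 1
    ext j
    by_cases hj : j = k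
    · subst hj
      simp [mul_inv_cancel_left₀ hl.ne']
    · simp [hj]
  rw [_root_.pd, heq.deriv_eq, deriv_const_mul_field,
    deriv_comp_mul_left l⁻¹ (fun t => f x (Function.update q k t)),
    inv_mul_cancel_left₀ hl.ne', Real.rpow_sub_one hl.ne', _root_.pd, smul_eq_mul]
  ring

theorem IsHomog.coord_mul (hf : IsHomog X h f) (k : ℕ) :
    IsHomog X (h + 1) fun x q => q k * f x q := by
  intro x hx q hq l hl
  beta_reduce
  rw [hf x hx q hq l hl, Real.rpow_add_one hl.ne']
  ring

theorem IsHomog.Dop (hX : IsOpen X) (hf : IsHomog X h f) : IsHomog X h (Dop f) := by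
  intro x hx q hq l hl
  have h1 : pdx f x (fun j => l * q j) = l ^ h * pdx f x q := by
    have heq : (fun t => f t fun j => l * q j) =ᶠ[nhds x] fun t => l ^ h * f t q := by
      filter_upwards [hX.mem_nhds hx] with t ht
      exact hf t ht q hq l hl
    rw [pdx, heq.deriv_eq, deriv_const_mul_field, pdx]
  have h2 : ∀ j, l * q (j + 1) * _root_.pd j f x (fun j => l * q j) =
      l ^ h * (q (j + 1) * _root_.pd j f x q) := fun j => by
    simpa using (hf.pd j).coord_mul (j + 1) x hx q hq l hl
  simp only [_root_.Dop, h1, h2, tsum_mul_left, mul_add]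

theorem IsHomog.iterate_Dop (hX : IsOpen X) (hf : IsHomog X h f) (k : ℕ) :
    IsHomog X h (_root_.Dop^[k] f) := by
  induction k with
  | zero => exact hf
  | succ k ih =>
    rw [Function.iterate_succ_apply']
    exact ih.Dop hX

theorem IsHomog.Lop (hX : IsOpen X) (hf : IsHomog X h f) : IsHomog X h (Lop f) := by
  intro x hx q hq l hl
  have hk : ∀ k, IsHomog X h fun x q => q 0 * _root_.pd k f x q := fun k => by
    simpa using (hf.pd k).coord_mul 0
  simp only [_root_.Lop, fun k => (hk k).iterate_Dop hX k x hx q hq l hl, mul_left_comm _ (l ^ h),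
    tsum_mul_left]

end Homogeneity

/-- If `f` is a `0`-homogeneous q-function, then `L f` is also
`0`-homogeneous, and `L (L f) = L f`. -/
theorem stmt9 (X : Set ℝ) (hX : IsOpenInterval X) (m : ℕ) (f : QFun)
    (hf : IsQFunc X m f) (hhom : IsHomog X 0 f) :
    IsHomog X 0 (Lop f) ∧
    (∀ x ∈ X, ∀ q : ℕ → ℝ, 0 < q 0 → Lop (Lop f) x q = Lop f x q) := by
  have hX := hX.1
  refine ⟨hhom.Lop hX, fun x hx q hq => ?_⟩
  obtain ⟨F, hFs, hFe⟩ := hf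
  have hF : JetRep X m F f := ⟨hFs, fun x _ q _ => hFe x q⟩
  have hfa : Represents f (toJetAlgebra f ⟨m, F, hF⟩ : jetAlgebra X) := fun _ _ _ _ => rfl
  have hP := fun k => (isDirDeriv_pd hX k).represents hX hfa
  have hLf := hfa.Lop hX (N := m + 1) fun k hk => (hP k).eq (g := fun _ _ => 0)
    (fun _ _ _ _ => rfl) fun x hx q hq => hF.pd_eq_zero hX hk hx hq
  obtain ⟨M, hM⟩ := exists_jetPartial_eq_zero hX _
  rw [hLf.Lop hX hM x hx q hq, hLf x hx q hq, lagrangeSum_jet_idem hX _ hM]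
  refine Subtype.ext (funext fun ⟨⟨x, q⟩, hx, hq⟩ => ?_)
  rw [AddSubmonoidClass.coe_finsetSum, Finset.sum_apply]
  refine Eq.trans (Finset.sum_congr rfl fun k _ => ?_) (hF.sum_mul_pd_eq_zero hX hhom hx hq)
  exact (((represents_jetCoord k).mul (hP k)) x hx q hq).symm

end
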